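/- Let p and q be probability distributions on ℤ with finite entropies H(p) = c and H(q) = d, and let x = ‖p‖_∞ and y = ‖q‖_∞. Then 2·H(p⋆q) − c − d ≥ d·x − h₂(x) + c·y − h₂(y). -/

import Mathlib

/-- Binary entropy function (in bits), with the convention `0 * log₂ 0 = 0`. -/
noncomputable def H2 (x : ℝ) : ℝ := -(x * Real.logb 2 x) - (1 - x) * Real.logb 2 (1 - x)

/-- `p` is a probability distribution on `ℤ`. -/
def IsPMF (p : ℤ → ℝ) : Prop := (∀ k, 0 ≤ p k) ∧ HasSum p 1

/-- Convolution of two distributions on `ℤ`. -/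
noncomputable def conv (p q : ℤ → ℝ) : ℤ → ℝ := fun k => ∑' j, p j * q (k - j)

/-- Shannon entropy (in bits) of a distribution on `ℤ`. -/
noncomputable def entH (p : ℤ → ℝ) : ℝ := ∑' k, -(p k * Real.logb 2 (p k))

open Real in
lemma key (p q : ℤ → ℝ) (C D : ℝ) (i0 : ℤ) (hp : IsPMF p) (hq : IsPMF q)
    (hc : HasSum (fun k => negMulLog (p k)) C) (hd : HasSum (fun k => negMulLog (q k)) D) :
    ∃ S, HasSum (fun k => negMulLog (conv p q k)) S ∧
      p i0 * D + C - negMulLog (p i0) + (1 - p i0) * log (1 - p i0) ≤ S := by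
  obtain ⟨hp0, hp1⟩ := hp
  obtain ⟨hq0, hq1⟩ := hq
  have ple : ∀ j, p j ≤ 1 := fun j => le_hasSum hp1 j (fun i _ => hp0 i)
  have qle : ∀ j, q j ≤ 1 := fun j => le_hasSum hq1 j (fun i _ => hq0 i)
  have prodHS : ∀ (f g : ℤ → ℝ) (a b : ℝ), HasSum f a → HasSum g b →
      HasSum (fun z : ℤ × ℤ => f z.1 * g z.2) (a * b) := by
    intro f g a b hf hg
    exact hf.mul hg (summable_mul_of_summable_norm hf.summable.norm hg.summable.norm)
  let e : ℤ × ℤ ≃ ℤ × ℤ := ⟨fun z => (z.2, z.1 - z.2), fun z => (z.1 + z.2, z.1),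
    fun z => by simp, fun z => by simp⟩
  have hpq : HasSum (fun z : ℤ × ℤ => p z.1 * q z.2) 1 := by
    simpa using prodHS p q 1 1 hp1 hq1
  have hpq' : HasSum (fun z : ℤ × ℤ => p z.2 * q (z.1 - z.2)) 1 := e.hasSum_iff.mpr hpq
  have hr : ∀ k, HasSum (fun j => p j * q (k - j)) (conv p q k) := fun k =>
    (hpq'.summable.prod_factor k).hasSum
  set r := conv p q with hrdef
  have hr1 : HasSum r 1 := hpq'.prod_fiberwise hr
  have hr0 : ∀ k, 0 ≤ r k := fun k => (hr k).nonneg (fun j => mul_nonneg (hp0 _) (hq0 _))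
  have rle : ∀ k, r k ≤ 1 := fun k => le_hasSum hr1 k (fun i _ => hr0 i)
  have rge : ∀ j m, p j * q m ≤ r (j + m) := by
    intro j m
    have := le_hasSum (hr (j + m)) j (fun i _ => mul_nonneg (hp0 _) (hq0 _))
    simpa using this
  -- summability of the joint function
  have hG : Summable (fun z : ℤ × ℤ => p z.1 * q z.2 * (-log (r (z.1 + z.2)))) := by
    have h1 := (prodHS _ q _ _ hc hq1).add (prodHS p _ _ _ hp1 hd)
    refine Summable.of_nonneg_of_le (fun z => ?_) (fun z => ?_) h1.summable
    · have := log_nonpos (hr0 (z.1 + z.2)) (rle _)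
      exact mul_nonneg (mul_nonneg (hp0 _) (hq0 _)) (by linarith)
    · obtain ⟨j, m⟩ := z
      simp only [negMulLog]
      rcases (hp0 j).eq_or_lt with h | h
      · simp [← h]
      rcases (hq0 m).eq_or_lt with h' | h'
      · simp [← h']
      have h2 := log_le_log (mul_pos h h') (rge j m)
      rw [log_mul h.ne' h'.ne'] at h2
      have := mul_le_mul_of_nonneg_left h2 (mul_pos h h').le
      nlinarith
  obtain ⟨S, hS⟩ := hG
  have hS' : HasSum (fun z : ℤ × ℤ => p z.2 * q (z.1 - z.2) * (-log (r z.1))) S := by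
    have := e.hasSum_iff.mpr hS
    simpa [e, Function.comp_def] using this
  refine ⟨S, ?_, ?_⟩
  · refine (hS'.prod_fiberwise (fun k => (hr k).mul_right (-log (r k)))).congr_fun ?_
    intro k; simp [negMulLog]
  have hxle := ple i0
  have hB : HasSum (fun m => negMulLog (q m) + q m - r (i0 + m)) (D + 1 - 1) :=
    (hd.add hq1).sub ((Equiv.addLeft i0).hasSum_iff.mpr hr1)
  have hI : HasSum (fun j => if j = i0 then p i0 else 0) (p i0) := hasSum_ite_eq i0 (p i0)
  have hI2 : HasSum (fun j => if j = i0 then negMulLog (p i0) else 0) (negMulLog (p i0)) :=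
    hasSum_ite_eq i0 _
  have hA : HasSum (fun j => if j = i0 then 0 else
      negMulLog (p j) + p j * (log (1 - p i0) + 1))
      (C - negMulLog (p i0) + (1 - p i0) * (log (1 - p i0) + 1)) := by
    refine ((hc.sub hI2).add ((hp1.sub hI).mul_right (log (1 - p i0) + 1))).congr_fun ?_
    intro j
    by_cases h : j = i0
    · subst h; simp
    · simp [h]
  have hR : HasSum (fun z : ℤ × ℤ => r (z.1 + z.2) * q z.2) 1 := by
    let e2 : ℤ × ℤ ≃ ℤ × ℤ := ⟨fun z => (z.1 + z.2, z.2), fun z => (z.1 - z.2, z.2),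
      fun z => by simp, fun z => by simp⟩
    have := e2.hasSum_iff.mpr (prodHS r q 1 1 hr1 hq1)
    simpa [e2, Function.comp_def] using this
  have hL := ((prodHS _ _ _ _ hI hB).add (prodHS _ _ _ _ hA hq1)).sub (hR.mul_left (1 - p i0))
  have hfin := hasSum_le (fun z => ?_) hL hS
  · linarith
  obtain ⟨j, m⟩ := z
  have gibbs : ∀ a b : ℝ, 0 < a → 0 < b → a * log b ≤ a * log a + b - a := by
    intro a b ha hb
    have h := log_le_sub_one_of_pos (div_pos hb ha)
    rw [log_div hb.ne' ha.ne'] at h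
    have h2 := mul_le_mul_of_nonneg_left h ha.le
    have : a * (b / a - 1) = b - a := by field_simp
    linarith
  have hrr := hr0 (j + m)
  have hpp := hp0 j
  have hqq := hq0 m
  have hn : 0 ≤ (1 - p i0) * (r (j + m) * q m) := by
    have : 0 ≤ 1 - p i0 := by linarith
    positivity
  by_cases hj : j = i0
  · subst hj
    simp only [if_true, negMulLog, zero_mul, add_zero]
    rcases hpp.eq_or_lt with h | h
    · simp only [← h] at hn ⊢; linarith
    rcases hqq.eq_or_lt with h' | h'
    · simp only [← h']
      have := mul_nonneg hpp hrr
      simp; exact this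
    have hrp : 0 < r (j + m) := lt_of_lt_of_le (mul_pos h h') (rge j m)
    have := mul_le_mul_of_nonneg_left (gibbs _ _ h' hrp) h.le
    nlinarith
  · simp only [if_neg hj, negMulLog, zero_mul, zero_add]
    rcases hpp.eq_or_lt with h | h
    · simp only [← h]; simp; exact hn
    rcases hqq.eq_or_lt with h' | h'
    · simp [← h']
    have hrp : 0 < r (j + m) := lt_of_lt_of_le (mul_pos h h') (rge j m)
    have hsum : p j + p i0 ≤ 1 := by
      have := sum_le_hasSum {j, i0} (fun i _ => hp0 i) hp1
      rwa [Finset.sum_pair hj] at this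
    have hx1 : 0 < 1 - p i0 := by linarith
    have h3 := gibbs _ _ h (mul_pos hx1 hrp)
    rw [log_mul hx1.ne' hrp.ne'] at h3
    have := mul_le_mul_of_nonneg_left h3 h'.le
    nlinarith

lemma exists_mode (p : ℤ → ℝ) (hp : IsPMF p) : ∃ i0, p i0 = ⨆ i, p i := by
  obtain ⟨hp0, hp1⟩ := hp
  have : ∃ k, 0 < p k := by
    by_contra! h
    have : p = 0 := funext fun k => le_antisymm (h k) (hp0 k)
    subst this
    exact zero_ne_one (hasSum_zero.unique hp1)
  obtain ⟨k, hk⟩ := this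
  have hf : {i | p k ≤ p i}.Finite := by
    have := hp1.summable.tendsto_cofinite_zero.eventually (gt_mem_nhds hk)
    rw [Filter.eventually_cofinite] at this
    simpa only [not_lt] using this
  obtain ⟨i0, hi0, hmax⟩ := Set.exists_max_image _ p hf ⟨k, le_refl (p k)⟩
  have hall : ∀ i, p i ≤ p i0 := by
    intro i
    by_cases h : p k ≤ p i
    · exact hmax i h
    · exact (not_le.mp h).le.trans hi0
  exact ⟨i0, le_antisymm (le_ciSup (f := p) ⟨p i0, by rintro _ ⟨i, rfl⟩; exact hall i⟩ i0)
    (ciSup_le hall)⟩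

lemma conv_comm' (p q : ℤ → ℝ) : conv p q = conv q p := by
  funext k
  unfold conv
  rw [← (Equiv.subLeft k).tsum_eq]
  simp [mul_comm]

lemma key2 (p q : ℤ → ℝ) (c d x : ℝ) (hp : IsPMF p) (hq : IsPMF q)
    (hc : HasSum (fun k => -(p k * Real.logb 2 (p k))) c)
    (hd : HasSum (fun k => -(q k * Real.logb 2 (q k))) d)
    (hx : x = ⨆ i, p i) : x * d + c - H2 x ≤ entH (conv p q) := by
  obtain ⟨i0, hi0⟩ := exists_mode p hp
  rw [← hi0] at hx
  have hl : 0 < Real.log 2 := Real.log_pos (by norm_num)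
  have e : ∀ t : ℝ, -(t * Real.logb 2 t) * Real.log 2 = Real.negMulLog t := by
    intro t; simp only [Real.logb, Real.negMulLog]; field_simp
  have hc' := hc.mul_right (Real.log 2)
  have hd' := hd.mul_right (Real.log 2)
  simp only [e] at hc' hd'
  obtain ⟨S, hS, hle⟩ := key p q _ _ i0 hp hq hc' hd'
  have hE : entH (conv p q) * Real.log 2 = S := by
    unfold entH
    rw [← tsum_mul_right]
    simp only [e]
    exact hS.tsum_eq
  refine le_of_mul_le_mul_right ?_ hl
  rw [hE]
  refine le_trans (le_of_eq ?_) hle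
  have e2 := e (1 - x)
  have e1 := e x
  rw [← hx]
  simp only [Real.negMulLog] at *
  unfold H2
  linarith


/-- if `H(p) = c`, `H(q) = d` are finite, `x = ‖p‖_∞` and `y = ‖q‖_∞`, then
`2·H(p⋆q) − c − d ≥ d·x − h₂(x) + c·y − h₂(y)`. -/
theorem stmt12 (p q : ℤ → ℝ) (c d x y : ℝ) (hp : IsPMF p) (hq : IsPMF q)
    (hc : HasSum (fun k => -(p k * Real.logb 2 (p k))) c)
    (hd : HasSum (fun k => -(q k * Real.logb 2 (q k))) d)
    (hx : x = ⨆ i, p i) (hy : y = ⨆ i, q i) :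
    2 * entH (conv p q) - c - d ≥ d * x - H2 x + c * y - H2 y := by
  have h1 := key2 p q c d x hp hq hc hd hx
  have h2 := key2 q p d c y hq hp hd hc hy
  rw [conv_comm' q p] at h2
  linarith
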